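/- Let X = λ₂N + λ₃B be an isotropic vector field along α with λ₂, λ₃ : ℝ → ℝ smooth. Then X is Fermi–Walker transported along α if and only if λ₂κ = 0 identically and there exist constants c₁, c₂ such that λ₂(x) = c₁ cos(∫₁ˣ τ(t) dt) + c₂ sin(∫₁ˣ τ(t) dt) and λ₃(x) = c₂ cos(∫₁ˣ τ(t) dt) − c₁ sin(∫₁ˣ τ(t) dt) for all x. -/

import Mathlib

/-- The Galilean scalar product on `ℝ³`: `v₁w₁` if `v₁ ≠ 0` or `w₁ ≠ 0`,
and `v₂w₂ + v₃w₃` if `v₁ = 0` and `w₁ = 0`. -/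
noncomputable def gProd (v w : Fin 3 → ℝ) : ℝ :=
  if v 0 ≠ 0 ∨ w 0 ≠ 0 then v 0 * w 0 else v 1 * w 1 + v 2 * w 2

/-- The admissible curve `α(x) = (x, y(x), z(x))` in Galilean 3-space. -/
noncomputable def curve (y z : ℝ → ℝ) : ℝ → Fin 3 → ℝ :=
  fun x => ![x, y x, z x]

/-- The Fermi–Walker derivative along `α = curve y z`:
`∇̃_T X = X' − ⟨T,X⟩A + ⟨A,X⟩T`, where `T = α'` and `A = T' = α''`. -/
noncomputable def FW (y z : ℝ → ℝ) (X : ℝ → Fin 3 → ℝ) (x : ℝ) : Fin 3 → ℝ :=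
  deriv X x
    - gProd (deriv (curve y z) x) (X x) • deriv (deriv (curve y z)) x
    + gProd (deriv (deriv (curve y z)) x) (X x) • deriv (curve y z) x

/-- The tangent `T = α' = (1, y', z')`. -/
noncomputable def Tvec (y z : ℝ → ℝ) (x : ℝ) : Fin 3 → ℝ :=
  ![1, deriv y x, deriv z x]

/-- The curvature `κ = √(y''² + z''²)`. -/
noncomputable def kappa (y z : ℝ → ℝ) (x : ℝ) : ℝ :=
  Real.sqrt (deriv (deriv y) x ^ 2 + deriv (deriv z) x ^ 2)

/-- The principal normal `N = (1/κ)(0, y'', z'')`. -/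
noncomputable def Nvec (y z : ℝ → ℝ) (x : ℝ) : Fin 3 → ℝ :=
  (kappa y z x)⁻¹ • ![0, deriv (deriv y) x, deriv (deriv z) x]

/-- The binormal `B = (1/κ)(0, −z'', y'')`. -/
noncomputable def Bvec (y z : ℝ → ℝ) (x : ℝ) : Fin 3 → ℝ :=
  (kappa y z x)⁻¹ • ![0, -deriv (deriv z) x, deriv (deriv y) x]

/-- The torsion `τ = det(α', α'', α''') / κ²`. -/
noncomputable def tors (y z : ℝ → ℝ) (x : ℝ) : ℝ :=
  (Matrix.of ![![(1 : ℝ), deriv y x, deriv z x],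
    ![0, deriv (deriv y) x, deriv (deriv z) x],
    ![0, deriv (deriv (deriv y)) x, deriv (deriv (deriv z)) x]]).det / kappa y z x ^ 2

/-- A smooth function on the line has a smooth derivative. -/
theorem ContDiff.deriv_top {f : ℝ → ℝ} (hf : ContDiff ℝ (⊤ : ℕ∞) f) :
    ContDiff ℝ (⊤ : ℕ∞) (deriv f) :=
  (contDiff_infty_iff_deriv.1 hf).2

theorem HasDerivAt.vec3 {f g h : ℝ → ℝ} {f' g' h' x : ℝ} (hf : HasDerivAt f f' x)
    (hg : HasDerivAt g g' x) (hh : HasDerivAt h h' x) :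
    HasDerivAt (fun t => ![f t, g t, h t]) ![f', g', h'] x := by
  rw [hasDerivAt_pi]
  intro i
  fin_cases i
  · exact hf
  · exact hg
  · exact hh

theorem deriv_curve {y z : ℝ → ℝ} (hy : Differentiable ℝ y) (hz : Differentiable ℝ z) :
    deriv (curve y z) = Tvec y z :=
  funext fun x => ((hasDerivAt_id x).vec3 (hy x).hasDerivAt (hz x).hasDerivAt).deriv

theorem deriv_Tvec {y z : ℝ → ℝ} (hy : Differentiable ℝ (deriv y))
    (hz : Differentiable ℝ (deriv z)) (x : ℝ) :
    deriv (Tvec y z) x = ![0, deriv (deriv y) x, deriv (deriv z) x] :=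
  ((hasDerivAt_const x (1 : ℝ)).vec3 (hy x).hasDerivAt (hz x).hasDerivAt).deriv

theorem kappa_sq (y z : ℝ → ℝ) (x : ℝ) :
    kappa y z x ^ 2 = deriv (deriv y) x ^ 2 + deriv (deriv z) x ^ 2 :=
  Real.sq_sqrt (by positivity)

theorem tors_eq (y z : ℝ → ℝ) (x : ℝ) :
    tors y z x = (deriv (deriv y) x * deriv (deriv (deriv z)) x
      - deriv (deriv z) x * deriv (deriv (deriv y)) x) / kappa y z x ^ 2 := by
  simp [tors, Matrix.det_fin_three]

theorem isotropic_field_eq (y z : ℝ → ℝ) (a b x : ℝ) :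
    a • Nvec y z x + b • Bvec y z x =
      ![0, a * (deriv (deriv y) x / kappa y z x) - b * (deriv (deriv z) x / kappa y z x),
        a * (deriv (deriv z) x / kappa y z x) + b * (deriv (deriv y) x / kappa y z x)] := by
  ext i
  fin_cases i <;> simp [Nvec, Bvec] <;> ring

/-- Along an isotropic field `λ₂N + λ₃B` the Fermi–Walker derivative is `X' + λ₂κT`. -/
theorem FW_isotropic {y z : ℝ → ℝ} (hy : ContDiff ℝ (⊤ : ℕ∞) y) (hz : ContDiff ℝ (⊤ : ℕ∞) z)
    {x : ℝ} (hκ : 0 < kappa y z x) {X : ℝ → Fin 3 → ℝ} {a b : ℝ}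
    (hX : X x = a • Nvec y z x + b • Bvec y z x) :
    FW y z X x = deriv X x + (a * kappa y z x) • Tvec y z x := by
  have hT : gProd (Tvec y z x) (X x) = 0 := by
    rw [hX, isotropic_field_eq]
    simp [gProd, Tvec]
  have hA : gProd (deriv (Tvec y z) x) (X x) = a * kappa y z x := by
    rw [hX, isotropic_field_eq,
      deriv_Tvec (hy.deriv_top.differentiable (by simp)) (hz.deriv_top.differentiable (by simp))]
    simp only [gProd, Matrix.cons_val_zero, Matrix.cons_val_one, Matrix.cons_val, ne_eq,
      not_true_eq_false, or_self, if_false]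
    field_simp
    linear_combination (-a) * kappa_sq y z x
  rw [FW, deriv_curve (hy.differentiable (by simp)) (hz.differentiable (by simp)), hT, hA]
  simp

theorem contDiff_kappa {y z : ℝ → ℝ} (hy : ContDiff ℝ (⊤ : ℕ∞) y) (hz : ContDiff ℝ (⊤ : ℕ∞) z)
    (hκ : ∀ x, 0 < kappa y z x) : ContDiff ℝ (⊤ : ℕ∞) (kappa y z) := by
  refine ((hy.deriv_top.deriv_top.pow 2).add (hz.deriv_top.deriv_top.pow 2)).sqrt fun x => ?_
  have := kappa_sq y z x
  have := pow_pos (hκ x) 2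
  linarith

theorem continuous_tors {y z : ℝ → ℝ} (hy : ContDiff ℝ (⊤ : ℕ∞) y)
    (hz : ContDiff ℝ (⊤ : ℕ∞) z) (hκ : ∀ x, 0 < kappa y z x) : Continuous (tors y z) := by
  rw [funext (tors_eq y z)]
  have hy2 := hy.deriv_top.deriv_top
  have hz2 := hz.deriv_top.deriv_top
  exact ((hy2.continuous.mul hz2.deriv_top.continuous).sub
    (hz2.continuous.mul hy2.deriv_top.continuous)).div
    ((contDiff_kappa hy hz hκ).continuous.pow 2) fun x => pow_ne_zero 2 (hκ x).ne'

theorem hasDerivAt_kappa {y z : ℝ → ℝ} (hy : ContDiff ℝ (⊤ : ℕ∞) y)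
    (hz : ContDiff ℝ (⊤ : ℕ∞) z) (hκ : ∀ x, 0 < kappa y z x) (x : ℝ) :
    HasDerivAt (kappa y z) ((deriv (deriv y) x * deriv (deriv (deriv y)) x
      + deriv (deriv z) x * deriv (deriv (deriv z)) x) / kappa y z x) x := by
  have hy2 := (hy.deriv_top.deriv_top.differentiable (by simp) x).hasDerivAt
  have hz2 := (hz.deriv_top.deriv_top.differentiable (by simp) x).hasDerivAt
  have hpos : deriv (deriv y) x ^ 2 + deriv (deriv z) x ^ 2 ≠ 0 := by
    rw [← kappa_sq]
    exact pow_ne_zero 2 (hκ x).ne'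
  refine (((hy2.pow 2).add (hz2.pow 2)).sqrt hpos).congr_deriv ?_
  change _ / (2 * kappa y z x) = _
  have := (hκ x).ne'
  field_simp
  simp
  ring

/-- A solution of `u' = -τv`, `v' = τu` is a rotation by a primitive `θ` of `τ`. -/
theorem exists_rotation_of_hasDerivAt {u v θ τ : ℝ → ℝ}
    (hu : ∀ x, HasDerivAt u (-(τ x * v x)) x) (hv : ∀ x, HasDerivAt v (τ x * u x) x)
    (hθ : ∀ x, HasDerivAt θ (τ x) x) :
    ∃ a b : ℝ, ∀ x, u x = a * Real.cos (θ x) - b * Real.sin (θ x) ∧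
      v x = a * Real.sin (θ x) + b * Real.cos (θ x) := by
  have ha : ∀ x, HasDerivAt (fun t => u t * Real.cos (θ t) + v t * Real.sin (θ t)) 0 x :=
    fun x => (((hu x).mul (hθ x).cos).add ((hv x).mul (hθ x).sin)).congr_deriv (by ring)
  have hb : ∀ x, HasDerivAt (fun t => v t * Real.cos (θ t) - u t * Real.sin (θ t)) 0 x :=
    fun x => (((hv x).mul (hθ x).cos).sub ((hu x).mul (hθ x).sin)).congr_deriv (by ring)
  refine ⟨u 0 * Real.cos (θ 0) + v 0 * Real.sin (θ 0),
    v 0 * Real.cos (θ 0) - u 0 * Real.sin (θ 0), fun x => ?_⟩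
  have ha' := is_const_of_deriv_eq_zero (fun x => (ha x).differentiableAt)
    (fun x => (ha x).deriv) 0 x
  have hb' := is_const_of_deriv_eq_zero (fun x => (hb x).differentiableAt)
    (fun x => (hb x).deriv) 0 x
  rw [ha', hb']
  constructor
  · linear_combination (-u x) * Real.sin_sq_add_cos_sq (θ x)
  · linear_combination (-v x) * Real.sin_sq_add_cos_sq (θ x)

/-- The normal plane frame rotates by the integral of the torsion. -/
theorem exists_normal_eq_rotation {y z : ℝ → ℝ} (hy : ContDiff ℝ (⊤ : ℕ∞) y)
    (hz : ContDiff ℝ (⊤ : ℕ∞) z) (hκ : ∀ x, 0 < kappa y z x) (x₀ : ℝ) :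
    ∃ a b : ℝ, ∀ x,
      deriv (deriv y) x / kappa y z x =
        a * Real.cos (∫ t in x₀..x, tors y z t) - b * Real.sin (∫ t in x₀..x, tors y z t) ∧
      deriv (deriv z) x / kappa y z x =
        a * Real.sin (∫ t in x₀..x, tors y z t) + b * Real.cos (∫ t in x₀..x, tors y z t) := by
  have hy2 x := (hy.deriv_top.deriv_top.differentiable (by simp) x).hasDerivAt
  have hz2 x := (hz.deriv_top.deriv_top.differentiable (by simp) x).hasDerivAt
  refine exists_rotation_of_hasDerivAt (u := fun x => deriv (deriv y) x / kappa y z x)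
    (v := fun x => deriv (deriv z) x / kappa y z x) (τ := tors y z)
    (fun x => ?_) (fun x => ?_) fun x => ?_
  · refine ((hy2 x).div (hasDerivAt_kappa hy hz hκ x) (hκ x).ne').congr_deriv ?_
    rw [tors_eq]
    have := (hκ x).ne'
    field_simp
    linear_combination deriv (deriv (deriv y)) x * kappa_sq y z x
  · refine ((hz2 x).div (hasDerivAt_kappa hy hz hκ x) (hκ x).ne').congr_deriv ?_
    rw [tors_eq]
    have := (hκ x).ne'
    field_simp
    linear_combination deriv (deriv (deriv z)) x * kappa_sq y z x
  · exact (continuous_tors hy hz hκ).integral_hasStrictDerivAt x₀ x |>.hasDerivAt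

/-- An isotropic field `X = λ₂N + λ₃B` is Fermi–Walker transported iff
`λ₂κ = 0` identically and `λ₂, λ₃` are the stated cosine/sine combinations of `∫₁ˣ τ`. -/
theorem fermiWalker_transported_isotropic_iff
    (y z : ℝ → ℝ) (hy : ContDiff ℝ (⊤ : ℕ∞) y) (hz : ContDiff ℝ (⊤ : ℕ∞) z)
    (hκ : ∀ x, 0 < kappa y z x)
    (lam₂ lam₃ : ℝ → ℝ) (h₂ : ContDiff ℝ (⊤ : ℕ∞) lam₂) (h₃ : ContDiff ℝ (⊤ : ℕ∞) lam₃)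
    (X : ℝ → Fin 3 → ℝ)
    (hX : ∀ x, X x = lam₂ x • Nvec y z x + lam₃ x • Bvec y z x) :
    (∀ x : ℝ, FW y z X x = 0) ↔
      ((∀ x : ℝ, lam₂ x * kappa y z x = 0) ∧ ∃ c₁ c₂ : ℝ, ∀ x : ℝ,
        lam₂ x = c₁ * Real.cos (∫ t in (1:ℝ)..x, tors y z t)
               + c₂ * Real.sin (∫ t in (1:ℝ)..x, tors y z t) ∧
        lam₃ x = c₂ * Real.cos (∫ t in (1:ℝ)..x, tors y z t)
               - c₁ * Real.sin (∫ t in (1:ℝ)..x, tors y z t)) := by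
  have hX' : X = fun x => ![0,
      lam₂ x * (deriv (deriv y) x / kappa y z x) - lam₃ x * (deriv (deriv z) x / kappa y z x),
      lam₂ x * (deriv (deriv z) x / kappa y z x) + lam₃ x * (deriv (deriv y) x / kappa y z x)] :=
    funext fun x => (hX x).trans (isotropic_field_eq y z _ _ x)
  have hFW x : FW y z X x = deriv X x + (lam₂ x * kappa y z x) • Tvec y z x :=
    FW_isotropic hy hz (hκ x) (hX x)
  obtain ⟨a, b, hab⟩ := exists_normal_eq_rotation hy hz hκ 1
  constructor
  · intro h
    have hu : Differentiable ℝ fun x => deriv (deriv y) x / kappa y z x :=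
      (hy.deriv_top.deriv_top.div (contDiff_kappa hy hz hκ) fun x => (hκ x).ne').differentiable
        (by simp)
    have hv : Differentiable ℝ fun x => deriv (deriv z) x / kappa y z x :=
      (hz.deriv_top.deriv_top.div (contDiff_kappa hy hz hκ) fun x => (hκ x).ne').differentiable
        (by simp)
    have hl₂ : Differentiable ℝ lam₂ := h₂.differentiable (by simp)
    have hl₃ : Differentiable ℝ lam₃ := h₃.differentiable (by simp)
    have hd x := (hasDerivAt_const x (0 : ℝ)).vec3
      (((hl₂.mul hu).sub (hl₃.mul hv)) x).hasDerivAt (((hl₂.mul hv).add (hl₃.mul hu)) x).hasDerivAt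
    have hκ₂ : ∀ x, lam₂ x * kappa y z x = 0 := fun x => by
      have h0 := congrFun ((hFW x).symm.trans (h x)) 0
      have hd0 : deriv X x 0 = 0 := by
        rw [hX']
        exact congrFun (hd x).deriv 0
      simpa [hd0, Tvec] using h0
    have hdX : ∀ x, deriv X x = 0 := fun x => by
      have h0 := (hFW x).symm.trans (h x)
      simpa [hκ₂ x] using h0
    have hXd : Differentiable ℝ X := by
      rw [hX']
      exact fun x => (hd x).differentiableAt
    refine ⟨hκ₂, X 0 1 * a + X 0 2 * b, X 0 2 * a - X 0 1 * b, fun x => ?_⟩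
    rw [is_const_of_deriv_eq_zero hXd hdX 0 x]
    have h1 : X x 1 = lam₂ x * (deriv (deriv y) x / kappa y z x)
        - lam₃ x * (deriv (deriv z) x / kappa y z x) := by
      rw [hX']
      rfl
    have h2 : X x 2 = lam₂ x * (deriv (deriv z) x / kappa y z x)
        + lam₃ x * (deriv (deriv y) x / kappa y z x) := by
      rw [hX']
      rfl
    have hunit : (deriv (deriv y) x / kappa y z x) ^ 2
        + (deriv (deriv z) x / kappa y z x) ^ 2 = 1 := by
      rw [div_pow, div_pow, ← add_div, ← kappa_sq, div_self (pow_ne_zero 2 (hκ x).ne')]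
    obtain ⟨hu', hv'⟩ := hab x
    constructor
    · linear_combination X x 1 * hu' + X x 2 * hv' - (deriv (deriv y) x / kappa y z x) * h1
        - (deriv (deriv z) x / kappa y z x) * h2 - lam₂ x * hunit
    · linear_combination X x 2 * hu' - X x 1 * hv' + (deriv (deriv z) x / kappa y z x) * h1
        - (deriv (deriv y) x / kappa y z x) * h2 - lam₃ x * hunit
  · rintro ⟨hκ₂, c₁, c₂, hc⟩ x
    have hconst : X = fun _ => ![0, c₁ * a - c₂ * b, c₁ * b + c₂ * a] := by
      rw [hX']
      funext t
      rw [(hab t).1, (hab t).2, (hc t).1, (hc t).2]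
      have hsc := Real.sin_sq_add_cos_sq (∫ s in (1:ℝ)..t, tors y z s)
      congr 2
      · linear_combination (c₁ * a - c₂ * b) * hsc
      · congr 1
        linear_combination (c₁ * b + c₂ * a) * hsc
    rw [hFW, hκ₂, hconst]
    simp
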